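/- Let X, Y, Z be real Hilbert spaces with Y separable, and let F : X → Z and G : Y → Z be bounded linear operators. Then range(F) ⊆ range(G) if and only if there exists a constant C > 0 such that ‖F* z‖ ≤ C ‖G* z‖ for every z ∈ Z, where F* and G* denote the Hilbert-space adjoints of F and G. -/

import Mathlib

section RangeInclusion

open scoped InnerProductSpace

variable {X Y Z : Type*}
  [NormedAddCommGroup X] [InnerProductSpace ℝ X] [CompleteSpace X]
  [NormedAddCommGroup Y] [InnerProductSpace ℝ Y] [CompleteSpace Y]
  [NormedAddCommGroup Z] [InnerProductSpace ℝ Z] [CompleteSpace Z]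

/-- If `range F ⊆ range G`, the uniform boundedness principle bounds `‖F* z‖` by `‖G* z‖`. -/
theorem exists_norm_adjoint_le_of_range_subset (F : X →L[ℝ] Z) (G : Y →L[ℝ] Z)
    (h : Set.range F ⊆ Set.range G) :
    ∃ C > 0, ∀ z : Z, ‖F.adjoint z‖ ≤ C * ‖G.adjoint z‖ := by
  have key : ∀ x : X, ∃ M : ℝ, ∀ z : Z, |⟪F.adjoint z, x⟫_ℝ| ≤ M * ‖G.adjoint z‖ := by
    intro x
    obtain ⟨y, hy⟩ := h ⟨x, rfl⟩
    refine ⟨‖y‖, fun z => ?_⟩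
    rw [F.adjoint_inner_left, ← hy, ← G.adjoint_inner_left, mul_comm]
    exact abs_real_inner_le_norm _ _
  obtain ⟨C, hC⟩ := banach_steinhaus
    (g := fun z : Z => innerSL ℝ (‖G.adjoint z‖⁻¹ • F.adjoint z)) (fun x => by
      obtain ⟨M, hM⟩ := key x
      refine ⟨|M|, fun z => ?_⟩
      rw [innerSL_apply_apply, real_inner_smul_left, norm_mul, norm_inv, norm_norm,
        Real.norm_eq_abs, inv_mul_eq_div]
      refine div_le_of_le_mul₀ (norm_nonneg _) (abs_nonneg _) ((hM z).trans ?_)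
      gcongr
      exact le_abs_self M)
  refine ⟨max C 1, by positivity, fun z => ?_⟩
  rcases eq_or_ne (G.adjoint z) 0 with hz | hz
  · obtain ⟨M, hM⟩ := key (F.adjoint z)
    have := hM z
    rw [hz, norm_zero, mul_zero, abs_nonpos_iff, inner_self_eq_zero] at this
    simp [this, hz]
  · have := hC z
    rw [innerSL_apply_norm, norm_smul, norm_inv, norm_norm, inv_mul_eq_div,
      div_le_iff₀ (norm_pos_iff.2 hz)] at this
    exact this.trans (by gcongr; exact le_max_left _ _)

/-- If `‖F* z‖ ≤ C ‖G* z‖` for all `z`, then for each `x` the functional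
`G* z ↦ ⟪F* z, x⟫` is bounded on `range G*`, and a Riesz representative of an extension of it
is a preimage of `F x` under `G`. -/
theorem range_subset_of_norm_adjoint_le (F : X →L[ℝ] Z) (G : Y →L[ℝ] Z) {C : ℝ}
    (h : ∀ z : Z, ‖F.adjoint z‖ ≤ C * ‖G.adjoint z‖) :
    Set.range F ⊆ Set.range G := by
  rintro _ ⟨x, rfl⟩
  let f : Z →ₗ[ℝ] ℝ := (innerSL ℝ (F x)).toLinearMap
  let e : Z →ₗ[ℝ] Y := G.adjoint.toLinearMap
  have hf : ∃ M, ∀ z, ‖f z‖ ≤ M * ‖e z‖ := by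
    refine ⟨‖x‖ * C, fun z => ?_⟩
    calc ‖f z‖ = ‖⟪x, F.adjoint z⟫_ℝ‖ := by rw [F.adjoint_inner_right]; rfl
      _ ≤ ‖x‖ * ‖F.adjoint z‖ := norm_inner_le_norm _ _
      _ ≤ ‖x‖ * (C * ‖G.adjoint z‖) := by gcongr; exact h z
      _ = ‖x‖ * C * ‖e z‖ := (mul_assoc _ _ _).symm
  obtain ⟨g, hg, -⟩ := exists_extension_norm_eq _ (f.compLeftInverse e)
  refine ⟨(InnerProductSpace.toDual ℝ Y).symm g, ext_inner_right ℝ fun z => ?_⟩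
  rw [← G.adjoint_inner_right, InnerProductSpace.toDual_symm_apply]
  exact (hg ⟨e z, z, rfl⟩).trans (LinearMap.compLeftInverse_apply_of_bdd f e hf z _ rfl)

end RangeInclusion


/-- Zabczyk's range-inclusion criterion: for bounded operators `F : X → Z`,
`G : Y → Z` between real Hilbert spaces with `Y` separable,
`range F ⊆ range G` iff `‖F* z‖ ≤ C ‖G* z‖` for some `C > 0` and all `z`. -/
theorem range_subset_iff_adjoint_norm_le
    {X Y Z : Type*}
    [NormedAddCommGroup X] [InnerProductSpace ℝ X] [CompleteSpace X]
    [NormedAddCommGroup Y] [InnerProductSpace ℝ Y] [CompleteSpace Y]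
    [NormedAddCommGroup Z] [InnerProductSpace ℝ Z] [CompleteSpace Z]
    [TopologicalSpace.SeparableSpace Y]
    (F : X →L[ℝ] Z) (G : Y →L[ℝ] Z) :
    Set.range F ⊆ Set.range G ↔
      ∃ C > 0, ∀ z : Z,
        ‖ContinuousLinearMap.adjoint F z‖ ≤ C * ‖ContinuousLinearMap.adjoint G z‖ := by
  exact ⟨exists_norm_adjoint_le_of_range_subset F G, fun ⟨C, _, hC⟩ =>
    range_subset_of_norm_adjoint_le F G hC⟩
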